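/- arXiv:2512.21269 — 5 statements merged into one kernel-verified Lean document; each statement's English description precedes it below -/
import Mathlib

section
/- (AA–Momentum Equivalence.) Fix d, a memory depth m ≥ 1, points x_{k-m}, …, x_k in ℝ^d, a map r : ℝ^d → ℝ^d, and real coefficients θ_1, …, θ_m. Let y_{i+1} = x_i + r(x_i), and let γ^{(j)} = θ_{m-j} - θ_{m-j+1} with conventions θ_0 = θ_{m+1} = 0. Then the Anderson Acceleration update x_{k+1} = x_k + r(x_k) - ∑_{j=1}^{m} θ_j · (Δx_{k-m+j-1} + Δr_{k-m+j-1}) is equal to the adaptive multistep momentum update x_{k+1} = y_{k+1} + ∑_{j=1}^{m} γ^{(j)} (y_{k+1} - y_{k-j+1}). -/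
/-- Summation by parts for a sum of products of consecutive differences of `θ` with the
displacements of `G` from a fixed point `c`. -/
theorem sum_range_sub_smul_sub {R E : Type*} [CommRing R] [AddCommGroup E] [Module R E]
    (θ : ℕ → R) (G : ℕ → E) (c : E) (m : ℕ) :
    ∑ i ∈ Finset.range m, (θ i - θ (i + 1)) • (c - G i)
      = θ 0 • (c - G 0) - θ m • (c - G m)
        - ∑ i ∈ Finset.range m, θ (i + 1) • (G (i + 1) - G i) := by
  induction m with
  | zero => simp
  | succ m ih =>
    rw [Finset.sum_range_succ, Finset.sum_range_succ, ih]
    module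

theorem sum_Icc_one_eq_sum_range {E : Type*} [AddCommMonoid E] (f : ℕ → E) (m : ℕ) :
    ∑ j ∈ Finset.Icc 1 m, f j = ∑ i ∈ Finset.range m, f (i + 1) := by
  rw [Finset.range_eq_Ico, Finset.sum_Ico_add' f 0 m 1, zero_add, Finset.Ico_add_one_right_eq_Icc]

/-- AA–Momentum Equivalence: the Anderson Acceleration update
`x_{k+1} = x_k + r(x_k) - ∑_{j=1}^m θ_j (Δx_{k-m+j-1} + Δr_{k-m+j-1})` equals the
adaptive multistep momentum update `y_{k+1} + ∑_{j=1}^m γ^{(j)} (y_{k+1} - y_{k-j+1})`,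
where `y_{i+1} = x_i + r(x_i)` and `γ^{(j)} = θ_{m-j} - θ_{m-j+1}` with `θ_0 = θ_{m+1} = 0`. -/
theorem aa_momentum_equivalence (d m k : ℕ) (hm : 1 ≤ m) (hk : m ≤ k)
    (x : ℕ → EuclideanSpace ℝ (Fin d))
    (r : EuclideanSpace ℝ (Fin d) → EuclideanSpace ℝ (Fin d))
    (θ : ℕ → ℝ) (hθ0 : θ 0 = 0) (hθtop : θ (m + 1) = 0)
    (y : ℕ → EuclideanSpace ℝ (Fin d))
    (hy : ∀ i, y (i + 1) = x i + r (x i))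
    (γ : ℕ → ℝ) (hγ : ∀ j ∈ Finset.Icc 1 m, γ j = θ (m - j) - θ (m - j + 1)) :
    x k + r (x k)
      - ∑ j ∈ Finset.Icc 1 m, θ j •
          ((x (k - m + j) - x (k - m + j - 1)) + (r (x (k - m + j)) - r (x (k - m + j - 1))))
      = y (k + 1) + ∑ j ∈ Finset.Icc 1 m, γ j • (y (k + 1) - y (k - j + 1)) := by
  obtain ⟨n, rfl⟩ := Nat.exists_eq_add_of_le' hk
  have hmomentum : ∑ j ∈ Finset.Icc 1 m, γ j • (y (n + m + 1) - y (n + m - j + 1))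
      = ∑ i ∈ Finset.range m, (θ i - θ (i + 1)) • (y (n + m + 1) - y (n + i + 1)) := by
    rw [sum_Icc_one_eq_sum_range, ← Finset.sum_range_reflect]
    refine Finset.sum_congr rfl fun i hi => ?_
    rw [Finset.mem_range] at hi
    rw [hγ _ (Finset.mem_Icc.mpr ⟨by lia, by lia⟩),
      show m - (m - 1 - i + 1) = i by lia, show n + m - (m - 1 - i + 1) = n + i by lia]
  have handerson : ∑ j ∈ Finset.Icc 1 m, θ j •
        ((x (n + m - m + j) - x (n + m - m + j - 1))
          + (r (x (n + m - m + j)) - r (x (n + m - m + j - 1))))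
      = ∑ i ∈ Finset.range m, θ (i + 1) • (y (n + (i + 1) + 1) - y (n + i + 1)) := by
    rw [sum_Icc_one_eq_sum_range]
    refine Finset.sum_congr rfl fun i _ => ?_
    rw [hy, hy, Nat.add_sub_cancel, show n + (i + 1) - 1 = n + i by lia]
    module
  rw [hmomentum, handerson, sum_range_sub_smul_sub θ (fun i => y (n + i + 1)), hθ0, ← hy]
  module
end

section
/- (Energy Dissipation Rate.) Let f : ℝ^d → ℝ be twice continuously differentiable, let f* ∈ ℝ, let h > 0, and let M, c : (0, ∞) → ℝ be differentiable with M the effective mass and c the damping coefficient. Suppose x : (0, ∞) → ℝ^d is twice differentiable and solves the high-resolution ODE M(t) ẍ(t) + c(t) ẋ(t) + ∇f(x(t)) + √h · ∇²f(x(t)) ẋ(t) = 0 on an open interval I. Define the total energy E(t) = ½ M(t) ‖ẋ(t)‖² + (f(x(t)) - f*). Then for every t ∈ I, E'(t) = -(c(t) - ½ M'(t)) ‖ẋ(t)‖² - √h · ⟨ẋ(t), ∇²f(x(t)) ẋ(t)⟩. -/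
open scoped RealInnerProductSpace

/-- Energy Dissipation Rate: if `x` solves the high-resolution ODE
`M(t) ẍ + c(t) ẋ + ∇f(x) + √h ∇²f(x) ẋ = 0` on the open interval `(a, b) ⊆ (0, ∞)`,
then the total energy `E(t) = ½ M(t)‖ẋ(t)‖² + (f(x(t)) - f*)` satisfies
`E'(t) = -(c(t) - ½ M'(t))‖ẋ(t)‖² - √h ⟨ẋ(t), ∇²f(x(t)) ẋ(t)⟩`. -/
theorem energy_dissipation_rate (d : ℕ)
    (f : EuclideanSpace ℝ (Fin d) → ℝ) (hf : ContDiff ℝ 2 f)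
    (fstar : ℝ) (h : ℝ) (hh : 0 < h)
    (a b : ℝ) (ha : 0 ≤ a)
    (M c M' c' : ℝ → ℝ)
    (x x' x'' : ℝ → EuclideanSpace ℝ (Fin d))
    (hM : ∀ t ∈ Set.Ioo a b, HasDerivAt M (M' t) t)
    (hc : ∀ t ∈ Set.Ioo a b, HasDerivAt c (c' t) t)
    (hx : ∀ t ∈ Set.Ioo a b, HasDerivAt x (x' t) t)
    (hx' : ∀ t ∈ Set.Ioo a b, HasDerivAt x' (x'' t) t)
    (hode : ∀ t ∈ Set.Ioo a b,
      M t • x'' t + c t • x' t + gradient f (x t)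
        + Real.sqrt h • (fderiv ℝ (gradient f) (x t)) (x' t) = 0)
    (E : ℝ → ℝ)
    (hE : ∀ t, E t = (1 / 2) * M t * ‖x' t‖ ^ 2 + (f (x t) - fstar)) :
    ∀ t ∈ Set.Ioo a b,
      HasDerivAt E
        (-(c t - (1 / 2) * M' t) * ‖x' t‖ ^ 2
          - Real.sqrt h * ⟪x' t, (fderiv ℝ (gradient f) (x t)) (x' t)⟫) t := by
  intro t ht
  have hkin := ((hM t ht).const_mul (1 / 2)).mul (hx' t ht).norm_sq
  have hpot : HasDerivAt (fun s => f (x s)) ⟪gradient f (x t), x' t⟫ t := by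
    have hgrad := ((hf.differentiable two_ne_zero) (x t)).hasGradientAt.hasFDerivAt
    simpa [Function.comp_def] using hgrad.comp_hasDerivAt t (hx t ht)
  have hpower := congrArg (fun v => ⟪x' t, v⟫) (hode t ht)
  simp only [inner_add_right, inner_smul_right, inner_zero_right,
    real_inner_self_eq_norm_sq] at hpower
  rw [real_inner_comm] at hpot
  rw [funext hE]
  refine (hkin.add (hpot.sub_const fstar)).congr_deriv ?_
  linear_combination hpower
end

section
/- Let f : ℝ^d → ℝ be twice continuously differentiable and convex (so ∇²f(x) is positive semidefinite for every x), let f* ∈ ℝ, h > 0, and let M, c : (0, ∞) → ℝ be differentiable. Suppose x : (0, ∞) → ℝ^d is twice differentiable and solves M(t) ẍ + c(t) ẋ + ∇f(x) + √h ∇²f(x) ẋ = 0 on an open interval I, and that the dissipation condition c(t) ≥ ½ M'(t) holds on I. Then the total energy E(t) = ½ M(t)‖ẋ(t)‖² + (f(x(t)) - f*) satisfies E'(t) ≤ 0 for all t ∈ I; in particular E is nonincreasing on I. -/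
open scoped RealInnerProductSpace

/-- Derivative of the mechanical energy `½ M ‖v‖² + (f(x) - e)` along a curve `x` of
velocity `v`. -/
theorem hasDerivAt_mechanical_energy {F : Type*} [NormedAddCommGroup F] [InnerProductSpace ℝ F]
    [CompleteSpace F] {f : F → ℝ} {M : ℝ → ℝ} {x v : ℝ → F} {m t : ℝ} {w : F} (e : ℝ)
    (hf : DifferentiableAt ℝ f (x t)) (hM : HasDerivAt M m t) (hx : HasDerivAt x (v t) t)
    (hv : HasDerivAt v w t) :
    HasDerivAt (fun s => (1 / 2) * M s * ‖v s‖ ^ 2 + (f (x s) - e))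
      ((1 / 2) * m * ‖v t‖ ^ 2 + M t * ⟪v t, w⟫ + ⟪v t, gradient f (x t)⟫) t := by
  have hfx : HasDerivAt (fun s => f (x s)) ⟪v t, gradient f (x t)⟫ t := by
    have hcomp := hf.hasGradientAt.hasFDerivAt.comp_hasDerivAt t hx
    rwa [InnerProductSpace.toDual_apply_apply, real_inner_comm] at hcomp
  refine (((hM.const_mul (1 / 2)).mul hv.norm_sq).add (hfx.sub_const e)).congr_deriv ?_
  ring

/-- if `f` is C², convex (so its Hessian is positive semidefinite
everywhere), `x` solves the high-resolution ODE `M(t) ẍ + c(t) ẋ + ∇f(x) + √h ∇²f(x) ẋ = 0`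
on the open interval `(a, b) ⊆ (0, ∞)`, and the dissipation condition `c(t) ≥ ½ M'(t)`
holds there, then the energy `E(t) = ½ M(t)‖ẋ(t)‖² + (f(x(t)) - f*)` satisfies
`E'(t) ≤ 0` on the interval; in particular `E` is nonincreasing there. -/
theorem energy_monotone_decay (d : ℕ)
    (f : EuclideanSpace ℝ (Fin d) → ℝ) (hf : ContDiff ℝ 2 f)
    (hconv : ConvexOn ℝ Set.univ f)
    (hpsd : ∀ z v : EuclideanSpace ℝ (Fin d), 0 ≤ ⟪v, (fderiv ℝ (gradient f) z) v⟫)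
    (fstar : ℝ) (h : ℝ) (hh : 0 < h)
    (a b : ℝ) (ha : 0 ≤ a)
    (M c M' c' : ℝ → ℝ)
    (x x' x'' : ℝ → EuclideanSpace ℝ (Fin d))
    (hM : ∀ t ∈ Set.Ioo a b, HasDerivAt M (M' t) t)
    (hc : ∀ t ∈ Set.Ioo a b, HasDerivAt c (c' t) t)
    (hx : ∀ t ∈ Set.Ioo a b, HasDerivAt x (x' t) t)
    (hx' : ∀ t ∈ Set.Ioo a b, HasDerivAt x' (x'' t) t)
    (hode : ∀ t ∈ Set.Ioo a b,
      M t • x'' t + c t • x' t + gradient f (x t)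
        + Real.sqrt h • (fderiv ℝ (gradient f) (x t)) (x' t) = 0)
    (hdissip : ∀ t ∈ Set.Ioo a b, (1 / 2) * M' t ≤ c t)
    (E : ℝ → ℝ)
    (hE : ∀ t, E t = (1 / 2) * M t * ‖x' t‖ ^ 2 + (f (x t) - fstar)) :
    (∀ t ∈ Set.Ioo a b, deriv E t ≤ 0) ∧ AntitoneOn E (Set.Ioo a b) := by
  have hderiv : ∀ t ∈ Set.Ioo a b, HasDerivAt E
      ((1 / 2) * M' t * ‖x' t‖ ^ 2 + M t * ⟪x' t, x'' t⟫ + ⟪x' t, gradient f (x t)⟫) t := by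
    intro t ht
    rw [funext hE]
    exact hasDerivAt_mechanical_energy fstar (hf.differentiable two_ne_zero (x t))
      (hM t ht) (hx t ht) (hx' t ht)
  have hnonpos : ∀ t ∈ Set.Ioo a b, deriv E t ≤ 0 := by
    intro t ht
    rw [(hderiv t ht).deriv]
    have hpower := congrArg (fun u => ⟪x' t, u⟫) (hode t ht)
    simp only [inner_add_right, real_inner_smul_right, real_inner_self_eq_norm_sq,
      inner_zero_right] at hpower
    have hhess := mul_nonneg (Real.sqrt_nonneg h) (hpsd (x t) (x' t))
    have hdiss := mul_le_mul_of_nonneg_right (hdissip t ht) (sq_nonneg ‖x' t‖)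
    linarith
  refine ⟨hnonpos, antitoneOn_of_deriv_nonpos (convex_Ioo a b)
    (fun t ht => (hderiv t ht).continuousAt.continuousWithinAt) ?_ ?_⟩
  · rw [interior_Ioo]
    exact fun t ht => (hderiv t ht).differentiableAt.differentiableWithinAt
  · rwa [interior_Ioo]
end

section
/- (AA(1) as adaptive Heavy-Ball.) Fix x_{k-1}, x_k ∈ ℝ^d and a map r : ℝ^d → ℝ^d with Δr_{k-1} = r(x_k) - r(x_{k-1}) ≠ 0. The scalar θ* = ⟨r(x_k), Δr_{k-1}⟩ / ‖Δr_{k-1}‖² is the unique minimizer over θ ∈ ℝ of ‖r(x_k) - θ Δr_{k-1}‖², and the depth-1 Anderson update x_{k+1} = x_k + r(x_k) - θ* (Δx_{k-1} + Δr_{k-1}) equals y_{k+1} + γ (y_{k+1} - y_k) with momentum coefficient γ = -θ*, where y_{i+1} = x_i + r(x_i). -/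
open scoped RealInnerProductSpace

/-- The coefficient of the orthogonal projection of `a` onto the line spanned by `v ≠ 0` is the
strict minimizer of `θ ↦ ‖a - θ • v‖ ^ 2`. -/
theorem norm_sub_projection_smul_sq_lt {E : Type*} [NormedAddCommGroup E] [InnerProductSpace ℝ E]
    {a v : E} (hv : v ≠ 0) {θ : ℝ} (hθ : θ ≠ ⟪a, v⟫ / ‖v‖ ^ 2) :
    ‖a - (⟪a, v⟫ / ‖v‖ ^ 2) • v‖ ^ 2 < ‖a - θ • v‖ ^ 2 := by
  have hv2 : 0 < ‖v‖ ^ 2 := by positivity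
  have expand (t : ℝ) : ‖a - t • v‖ ^ 2 = ‖a‖ ^ 2 - 2 * (t * ⟪a, v⟫) + t ^ 2 * ‖v‖ ^ 2 := by
    rw [norm_sub_sq_real, real_inner_smul_right, norm_smul, mul_pow, Real.norm_eq_abs, sq_abs]
  have gap : 0 < (θ - ⟪a, v⟫ / ‖v‖ ^ 2) ^ 2 * ‖v‖ ^ 2 :=
    mul_pos (sq_pos_of_ne_zero (sub_ne_zero.mpr hθ)) hv2
  have inner_eq : ⟪a, v⟫ = ⟪a, v⟫ / ‖v‖ ^ 2 * ‖v‖ ^ 2 := (div_mul_cancel₀ _ hv2.ne').symm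
  rw [expand, expand]
  generalize ⟪a, v⟫ / ‖v‖ ^ 2 = s at *
  rw [inner_eq]
  linarith

/-- AA(1) as adaptive Heavy-Ball: with `Δr_{k-1} = r(x_k) - r(x_{k-1}) ≠ 0`,
the scalar `θ* = ⟨r(x_k), Δr_{k-1}⟩ / ‖Δr_{k-1}‖²` is the unique minimizer of
`θ ↦ ‖r(x_k) - θ Δr_{k-1}‖²`, and the depth-1 Anderson update
`x_{k+1} = x_k + r(x_k) - θ*(Δx_{k-1} + Δr_{k-1})` equals `y_{k+1} + γ (y_{k+1} - y_k)`
with `γ = -θ*`, where `y_{i+1} = x_i + r(x_i)`. -/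
theorem aa1_adaptive_heavy_ball (d : ℕ)
    (xkm1 xk : EuclideanSpace ℝ (Fin d))
    (r : EuclideanSpace ℝ (Fin d) → EuclideanSpace ℝ (Fin d))
    (hΔr : r xk - r xkm1 ≠ 0)
    (θstar : ℝ) (hθ : θstar = ⟪r xk, r xk - r xkm1⟫ / ‖r xk - r xkm1‖ ^ 2)
    (γ : ℝ) (hγ : γ = -θstar)
    (yk ykp1 : EuclideanSpace ℝ (Fin d))
    (hyk : yk = xkm1 + r xkm1) (hykp1 : ykp1 = xk + r xk) :
    (∀ θ : ℝ, θ ≠ θstar →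
      ‖r xk - θstar • (r xk - r xkm1)‖ ^ 2 < ‖r xk - θ • (r xk - r xkm1)‖ ^ 2) ∧
    xk + r xk - θstar • ((xk - xkm1) + (r xk - r xkm1)) = ykp1 + γ • (ykp1 - yk) := by
  subst hθ hγ hyk hykp1
  refine ⟨fun θ hne => norm_sub_projection_smul_sq_lt hΔr hne, ?_⟩
  module
end

section
/- (Consistency of Nesterov's scheme with the AVD ODE.) Let f : ℝ^d → ℝ be continuously differentiable with locally Lipschitz gradient, let x : (0, ∞) → ℝ^d be three times continuously differentiable, and fix t > 0. Then, as h → 0⁺, the one-step residual of Nesterov's recursion along the curve x satisfies x(t + √h) - x(t) - (1 - 3√h/t)(x(t) - x(t - √h)) + h∇f(x(t)) = h·[ẍ(t) + (3/t)ẋ(t) + ∇f(x(t))] + O(h^{3/2}). In particular, if x solves the AVD equation ẍ + (3/t)ẋ + ∇f(x) = 0 at t, then the residual is O(h^{3/2}). -/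
open Asymptotics

open Filter Topology

section Taylor

variable {E : Type*} [NormedAddCommGroup E] [NormedSpace ℝ E]

/-- Taylor's theorem with a big-O remainder, on a convex set. -/
theorem taylor_isBigO {f : ℝ → E} {x₀ : ℝ} {n : ℕ} {s : Set ℝ} (hs : Convex ℝ s) (hx₀ : x₀ ∈ s)
    (hf : ContDiffOn ℝ (n + 1 : ℕ) f s) :
    (fun x ↦ f x - taylorWithinEval f n s x₀ x) =O[𝓝[s] x₀] fun x ↦ (x - x₀) ^ (n + 1) := by
  have hmonomial : (fun x ↦ taylorWithinEval f (n + 1) s x₀ x - taylorWithinEval f n s x₀ x)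
      =O[𝓝[s] x₀] fun x ↦ (x - x₀) ^ (n + 1) := by
    refine IsBigO.of_bound ‖((n + 1 : ℝ) * n.factorial)⁻¹ • iteratedDerivWithin (n + 1) f s x₀‖
      (Eventually.of_forall fun x ↦ le_of_eq ?_)
    rw [taylorWithinEval_succ, add_sub_cancel_left, mul_comm _ ((x - x₀) ^ (n + 1)), mul_smul,
      norm_smul, mul_comm]
  exact ((taylor_isLittleO hs hx₀ hf).isBigO.add hmonomial).congr_left fun x ↦ by abel

/-- The second order Taylor expansion of a `C³` function, in terms of iterated `deriv`s. -/
theorem ContDiffOn.taylor_two_isBigO {f : ℝ → E} {x₀ : ℝ} {s : Set ℝ} (hs : Convex ℝ s)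
    (hs' : IsOpen s) (hx₀ : x₀ ∈ s) (hf : ContDiffOn ℝ 3 f s) :
    (fun u ↦ f (x₀ + u) - (f x₀ + u • deriv f x₀ + (u ^ 2 / 2) • deriv (deriv f) x₀))
      =O[𝓝 0] fun u ↦ u ^ 3 := by
  have h := taylor_isBigO (n := 2) hs hx₀ hf
  rw [hs'.nhdsWithin_eq hx₀] at h
  have htranslate : Tendsto (fun u ↦ x₀ + u) (𝓝 0) (𝓝 x₀) := by
    simpa using (continuous_const_add x₀).tendsto 0
  refine (h.comp_tendsto htranslate).congr (fun u ↦ ?_) fun u ↦ by simp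
  simp only [Function.comp_apply, taylorWithinEval_succ, taylor_within_zero_eval,
    iteratedDerivWithin_of_isOpen hs' hx₀, iteratedDeriv_succ, iteratedDeriv_zero,
    add_sub_cancel_left]
  norm_num
  module

end Taylor

/-- Consistency of Nesterov's scheme with the AVD ODE: for `f` C¹ with
locally Lipschitz gradient and `x` three times continuously differentiable on `(0, ∞)`,
at fixed `t > 0` the one-step residual of Nesterov's recursion along the curve satisfies
`x(t+√h) - x(t) - (1 - 3√h/t)(x(t) - x(t-√h)) + h∇f(x(t))
  = h[ẍ(t) + (3/t)ẋ(t) + ∇f(x(t))] + O(h^{3/2})` as `h → 0⁺`; in particular if `x`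
solves the AVD equation at `t`, the residual is `O(h^{3/2})`. -/
theorem nesterov_avd_consistency (d : ℕ)
    (f : EuclideanSpace ℝ (Fin d) → ℝ) (hf : ContDiff ℝ 1 f)
    (hLip : LocallyLipschitz (gradient f))
    (x : ℝ → EuclideanSpace ℝ (Fin d)) (hx : ContDiffOn ℝ 3 x (Set.Ioi 0))
    (t : ℝ) (ht : 0 < t) :
    ((fun h : ℝ =>
        x (t + Real.sqrt h) - x t
          - (1 - 3 * Real.sqrt h / t) • (x t - x (t - Real.sqrt h))
          + h • gradient f (x t)
          - h • (deriv (deriv x) t + (3 / t) • deriv x t + gradient f (x t)))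
      =O[nhdsWithin 0 (Set.Ioi 0)] (fun h : ℝ => h ^ ((3 : ℝ) / 2))) ∧
    (deriv (deriv x) t + (3 / t) • deriv x t + gradient f (x t) = 0 →
      (fun h : ℝ =>
        x (t + Real.sqrt h) - x t
          - (1 - 3 * Real.sqrt h / t) • (x t - x (t - Real.sqrt h))
          + h • gradient f (x t))
      =O[nhdsWithin 0 (Set.Ioi 0)] (fun h : ℝ => h ^ ((3 : ℝ) / 2))) := by
  rw [and_iff_left_of_imp fun h hode ↦ by simpa only [hode, smul_zero, sub_zero] using h]
  set v := deriv x t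
  set a := deriv (deriv x) t
  let R : ℝ → EuclideanSpace ℝ (Fin d) := fun u ↦ x (t + u) - (x t + u • v + (u ^ 2 / 2) • a)
  have hR : R =O[𝓝 0] fun u ↦ u ^ 3 :=
    hx.taylor_two_isBigO (convex_Ioi 0) isOpen_Ioi ht
  have hRneg : (fun u ↦ R (-u)) =O[𝓝 0] fun u ↦ u ^ 3 := by
    have hneg : Tendsto (fun u : ℝ ↦ -u) (𝓝 0) (𝓝 0) := by
      simpa using (continuous_neg (G := ℝ)).tendsto 0
    exact (hR.comp_tendsto hneg).trans (IsBigO.of_bound 1 (Eventually.of_forall fun u ↦ by simp))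
  have hcoeff : (fun u : ℝ ↦ 1 - 3 * u / t) =O[𝓝 0] fun _ ↦ (1 : ℝ) :=
    (show ContinuousAt (fun u : ℝ ↦ 1 - 3 * u / t) 0 by fun_prop).tendsto.isBigO_one ℝ
  have hcubic : (fun u : ℝ ↦ (u ^ 3 * (3 / (2 * t))) • a) =O[𝓝 0] fun u ↦ u ^ 3 := by
    refine IsBigO.of_bound ‖(3 / (2 * t)) • a‖ (Eventually.of_forall fun u ↦ le_of_eq ?_)
    rw [mul_smul, norm_smul, mul_comm]
  have hmain : (fun u : ℝ ↦ R u + (1 - 3 * u / t) • R (-u) - (u ^ 3 * (3 / (2 * t))) • a)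
      =O[𝓝 0] fun u ↦ u ^ 3 :=
    (hR.add (by simpa using hcoeff.smul hRneg)).sub hcubic
  have hsqrt : Tendsto Real.sqrt (𝓝[>] 0) (𝓝 0) := by
    simpa using (Real.continuous_sqrt.tendsto 0).mono_left nhdsWithin_le_nhds
  refine (hmain.comp_tendsto hsqrt).congr' ?_ ?_
  · filter_upwards [self_mem_nhdsWithin] with h hh
    obtain ⟨u, hu, rfl⟩ : ∃ u : ℝ, 0 ≤ u ∧ h = u ^ 2 :=
      ⟨√h, Real.sqrt_nonneg h, (Real.sq_sqrt (le_of_lt hh)).symm⟩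
    simp only [Function.comp_apply, R, Real.sqrt_sq hu, ← sub_eq_add_neg]
    match_scalars <;> field_simp <;> ring
  · filter_upwards [self_mem_nhdsWithin] with h hh
    rw [Function.comp_apply, Real.sqrt_eq_rpow, ← Real.rpow_natCast, ← Real.rpow_mul (le_of_lt hh)]
    norm_num
end
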